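/- Suppose Δ is simply-laced (all roots have the same length). Let w ∈ Ŵ be minuscule with I_w ≠ ∅, and suppose the rootlet τ(I_w) = w(α₀) + δ is not a simple root. Then there exist at least two distinct abelian ideals J₁ ≠ J₂, each maximal with respect to inclusion among all abelian ideals of Δ⁺, with I_w ⊆ J₁ and I_w ⊆ J₂. -/

import Mathlib

open scoped BigOperators

/-- Data of a reduced irreducible crystallographic root system `Δ`, spanning a
`ℚ`-vector space `V` equipped with a Weyl-group-invariant inner product `B`,
together with a chosen system of positive roots `Pos` and the highest root `θ`. -/
structure RootSystemCtx (V : Type*) [AddCommGroup V] [Module ℚ V] where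
  /-- the invariant inner product `( , )` -/
  B : V →ₗ[ℚ] V →ₗ[ℚ] ℚ
  B_symm : ∀ x y : V, B x y = B y x
  B_posdef : ∀ x : V, x ≠ 0 → 0 < B x x
  /-- the set of roots -/
  Δ : Set V
  Δ_finite : Δ.Finite
  Δ_spans : Submodule.span ℚ Δ = ⊤
  zero_notMem_Δ : (0 : V) ∉ Δ
  neg_mem_Δ : ∀ α ∈ Δ, -α ∈ Δ
  reduced : ∀ α ∈ Δ, ∀ c : ℚ, c • α ∈ Δ → c = 1 ∨ c = -1
  crystallographic : ∀ α ∈ Δ, ∀ β ∈ Δ, ∃ n : ℤ, 2 * B α β / B β β = (n : ℚ)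
  reflect_mem : ∀ α ∈ Δ, ∀ β ∈ Δ, β - (2 * B β α / B α α) • α ∈ Δ
  irreducible : ∀ S : Set V, S ⊆ Δ → (∀ α ∈ S, ∀ β ∈ Δ \ S, B α β = 0) → S = ∅ ∨ S = Δ
  /-- the positive roots `Δ⁺` -/
  Pos : Set V
  pos_subset : Pos ⊆ Δ
  mem_pos_or_neg_pos : ∀ α ∈ Δ, α ∈ Pos ∨ -α ∈ Pos
  pos_not_neg : ∀ α ∈ Pos, -α ∉ Pos
  add_pos_mem : ∀ α ∈ Pos, ∀ β ∈ Pos, α + β ∈ Δ → α + β ∈ Pos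
  /-- the highest root `θ` -/
  θ : V
  θ_pos : θ ∈ Pos
  θ_highest : ∀ ν ∈ Δ, θ - ν ∈ AddSubmonoid.closure Pos

namespace RootSystemCtx

variable {V : Type*} [AddCommGroup V] [Module ℚ V] (ctx : RootSystemCtx V)

/-- the simple roots `Π`: indecomposable positive roots -/
def simple : Set V :=
  {α | α ∈ ctx.Pos ∧ ¬∃ β ∈ ctx.Pos, ∃ γ ∈ ctx.Pos, α = β + γ}

/-- `ρ`, the half-sum of all positive roots -/
noncomputable def ρ : V :=
  (1 / 2 : ℚ) • ∑ α ∈ (ctx.Δ_finite.subset ctx.pos_subset).toFinset, α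

/-- the coroot `μ∨ = 2μ/(μ,μ)` -/
noncomputable def coroot (μ : V) : V := (2 / ctx.B μ μ) • μ

/-- `Δ⁺_l`, the long positive roots (roots of the same length as `θ`) -/
def PosLong : Set V := {μ | μ ∈ ctx.Pos ∧ ctx.B μ μ = ctx.B ctx.θ ctx.θ}

/-- `Π_l`, the long simple roots -/
def SimpleLong : Set V := {μ | μ ∈ ctx.simple ∧ ctx.B μ μ = ctx.B ctx.θ ctx.θ}

/-- the dominance order `μ ≼ ν` on the root lattice: `ν - μ` is a nonnegative
integer combination of positive roots -/
def le (μ ν : V) : Prop := ν - μ ∈ AddSubmonoid.closure ctx.Pos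

/-- a (combinatorial) abelian ideal of `Δ⁺` -/
def IsAbelianIdeal (I : Set V) : Prop :=
  I ⊆ ctx.Pos ∧ (∀ μ ∈ I, ∀ ν ∈ I, μ + ν ∉ ctx.Δ) ∧
    ∀ γ ∈ I, ∀ ν ∈ ctx.Pos, γ + ν ∈ ctx.Δ → γ + ν ∈ I

/-- `γ` is a generator of the ideal `I` -/
def IsGenerator (I : Set V) (γ : V) : Prop := γ ∈ I ∧ ∀ α ∈ ctx.Pos, γ - α ∉ I

/-! ### The affine picture: `V̂ = V ⊕ ℚδ ⊕ ℚλ`, modelled as `V × ℚ × ℚ`,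
with `δ = (0,1,0)` and `λ = (0,0,1)`. -/

/-- the embedding of `V` into `V̂` -/
def emb (_ctx : RootSystemCtx V) (v : V) : V × ℚ × ℚ := (v, 0, 0)

/-- the imaginary root `δ` -/
def δhat (_ctx : RootSystemCtx V) : V × ℚ × ℚ := (0, 1, 0)

/-- the affine simple root `α₀ = δ - θ` -/
def alpha0 : V × ℚ × ℚ := (-ctx.θ, 1, 0)

/-- the extension of the inner product to `V̂`, with
`(δ,V)=(λ,V)=(δ,δ)=(λ,λ)=0` and `(δ,λ)=1` -/
noncomputable def Bhat : (V × ℚ × ℚ) →ₗ[ℚ] (V × ℚ × ℚ) →ₗ[ℚ] ℚ :=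
  LinearMap.mk₂ ℚ (fun x y => ctx.B x.1 y.1 + x.2.1 * y.2.2 + x.2.2 * y.2.1)
    (fun x x' y => by
      simp only [Prod.fst_add, Prod.snd_add, map_add, LinearMap.add_apply]; ring)
    (fun c x y => by
      simp only [Prod.smul_fst, Prod.smul_snd, map_smul, LinearMap.smul_apply,
        smul_eq_mul]; ring)
    (fun x y y' => by
      simp only [Prod.fst_add, Prod.snd_add, map_add]; ring)
    (fun c x y => by
      simp only [Prod.smul_fst, Prod.smul_snd, map_smul, smul_eq_mul]; ring)

/-- the set `Δ̂` of affine real roots -/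
def Δhat : Set (V × ℚ × ℚ) := {x | ∃ α ∈ ctx.Δ, ∃ k : ℤ, x = (α, (k : ℚ), 0)}

/-- the set `Δ̂⁺` of positive affine roots -/
def PosHat : Set (V × ℚ × ℚ) :=
  {x | ∃ α ∈ ctx.Pos, x = (α, 0, 0)} ∪
    {x | ∃ α ∈ ctx.Δ, ∃ k : ℤ, 1 ≤ k ∧ x = (α, (k : ℚ), 0)}

/-- the set `Π̂ = Π ∪ {α₀}` of affine simple roots -/
def SimpleHat : Set (V × ℚ × ℚ) :=
  {x | ∃ α ∈ ctx.simple, x = (α, (0 : ℚ), (0 : ℚ))} ∪ {ctx.alpha0}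

/-- the reflection `s_β : x ↦ x − (2(x,β)/(β,β))·β` in `V̂` -/
noncomputable def refl (β : V × ℚ × ℚ) : (V × ℚ × ℚ) ≃ₗ[ℚ] (V × ℚ × ℚ) :=
  if h : ctx.Bhat β β = 0 then LinearEquiv.refl ℚ _
  else
    Module.reflection (x := β) (f := (2 / ctx.Bhat β β) • ctx.Bhat β)
      (by simp only [LinearMap.smul_apply, smul_eq_mul]; field_simp)

/-- the affine Weyl group `Ŵ`, generated by the reflections `s_β`, `β ∈ Δ̂` -/
def What : Subgroup ((V × ℚ × ℚ) ≃ₗ[ℚ] (V × ℚ × ℚ)) :=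
  Subgroup.closure {g | ∃ β ∈ ctx.Δhat, g = ctx.refl β}

/-- the finite Weyl group `W`, generated by the reflections `s_α`, `α ∈ Δ`
(identified with a subgroup of `Ŵ`) -/
def Wfin : Subgroup ((V × ℚ × ℚ) ≃ₗ[ℚ] (V × ℚ × ℚ)) :=
  Subgroup.closure {g | ∃ α ∈ ctx.Δ, g = ctx.refl (α, (0 : ℚ), (0 : ℚ))}

/-- `N̂(w) = {β ∈ Δ̂⁺ : w(β) ∈ −Δ̂⁺}` -/
def Nhat (w : (V × ℚ × ℚ) ≃ₗ[ℚ] (V × ℚ × ℚ)) : Set (V × ℚ × ℚ) :=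
  {β | β ∈ ctx.PosHat ∧ -(w β) ∈ ctx.PosHat}

/-- a minuscule element of `Ŵ`: every element of `N̂(w)` has the form `δ - γ`
with `γ ∈ Δ⁺` -/
def IsMinuscule (w : (V × ℚ × ℚ) ≃ₗ[ℚ] (V × ℚ × ℚ)) : Prop :=
  w ∈ ctx.What ∧ ∀ β ∈ ctx.Nhat w, ∃ γ ∈ ctx.Pos, β = ctx.δhat - ctx.emb γ

/-- the abelian ideal `I_w` corresponding to a minuscule element `w` -/
def idealOf (w : (V × ℚ × ℚ) ≃ₗ[ℚ] (V × ℚ × ℚ)) : Set V :=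
  {γ | γ ∈ ctx.Pos ∧ ctx.δhat - ctx.emb γ ∈ ctx.Nhat w}

/-- the ideal `I` has rootlet `τ(I) = μ`, i.e. `I = I_w` for some minuscule `w`
with `w(α₀) + δ = μ` -/
def HasRootlet (I : Set V) (μ : V) : Prop :=
  ∃ w, ctx.IsMinuscule w ∧ ctx.idealOf w = I ∧ w ctx.alpha0 + ctx.δhat = ctx.emb μ

/-- `Ab_μ`, the set of nonempty abelian ideals with rootlet `μ` -/
def AbFiber (μ : V) : Set (Set V) := {I | I.Nonempty ∧ ctx.HasRootlet I μ}

/-- `N(u) = {γ ∈ Δ⁺ : u(γ) ∈ −Δ⁺}` for `u` in the finite Weyl group -/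
def Nfin (w : (V × ℚ × ℚ) ≃ₗ[ℚ] (V × ℚ × ℚ)) : Set V :=
  {γ | γ ∈ ctx.Pos ∧ -(w (ctx.emb γ)) ∈ ctx.PosHat}

/-- the length `l(u) = #N(u)` of an element of the finite Weyl group -/
noncomputable def lenFin (w : (V × ℚ × ℚ) ≃ₗ[ℚ] (V × ℚ × ℚ)) : ℕ :=
  (ctx.Nfin w).ncard

end RootSystemCtx

namespace RootSystemCtx

variable {V : Type*} [AddCommGroup V] [Module ℚ V] (ctx : RootSystemCtx V)

/-- all roots have the same length -/
def SimplyLaced : Prop := ∀ α ∈ ctx.Δ, ∀ β ∈ ctx.Δ, ctx.B α α = ctx.B β β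

variable {ctx}

theorem B_self_pos {α : V} (hα : α ∈ ctx.Δ) : 0 < ctx.B α α :=
  ctx.B_posdef α fun h => ctx.zero_notMem_Δ (h ▸ hα)

theorem SimplyLaced.cartan_eq_one (hsl : ctx.SimplyLaced) {α β : V} (hα : α ∈ ctx.Δ)
    (hβ : β ∈ ctx.Δ) (hne : α ≠ β) (hpos : 0 < ctx.B α β) :
    2 * ctx.B α β / ctx.B β β = 1 := by
  obtain ⟨n, hn⟩ := ctx.crystallographic α hα β hβ
  have hN := B_self_pos hβ
  have hd := ctx.B_posdef (α - β) (sub_ne_zero.2 hne)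
  simp only [map_sub, LinearMap.sub_apply] at hd
  rw [ctx.B_symm β α, hsl α hα β hβ] at hd
  have h1 : (0 : ℚ) < n := by rw [← hn]; positivity
  have h2 : (n : ℚ) < 2 := by rw [← hn, div_lt_iff₀ hN]; linarith
  have h1' : 0 < n := by exact_mod_cast h1
  have h2' : n < 2 := by exact_mod_cast h2
  have h3 : n = 1 := by omega
  rw [hn, h3, Int.cast_one]

theorem SimplyLaced.sub_mem (hsl : ctx.SimplyLaced) {α β : V} (hα : α ∈ ctx.Δ)
    (hβ : β ∈ ctx.Δ) (hne : α ≠ β) (hpos : 0 < ctx.B α β) : α - β ∈ ctx.Δ := by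
  have h := ctx.reflect_mem β hβ α hα
  rwa [hsl.cartan_eq_one hα hβ hne hpos, one_smul] at h

theorem SimplyLaced.multiset_eq_zero (hsl : ctx.SimplyLaced) (s : Multiset V)
    (hs : ∀ x ∈ s, x ∈ ctx.Pos) (h0 : s.sum = 0) : s = 0 := by
  classical
  induction hn : s.card using Nat.strong_induction_on generalizing s with
  | _ n ih =>
    rcases s.empty_or_exists_mem with rfl | ⟨a, ha⟩
    · rfl
    obtain ⟨t, rfl⟩ := Multiset.exists_cons_of_mem ha
    have haP := hs a ha
    have haN := B_self_pos (ctx.pos_subset haP)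
    obtain ⟨b, hb, hab⟩ : ∃ b ∈ t, ctx.B a b < 0 := by
      by_contra! hcon
      have hsum : 0 ≤ ctx.B a t.sum := by
        rw [map_multiset_sum]
        refine Multiset.sum_nonneg fun x hx => ?_
        obtain ⟨y, hy, rfl⟩ := Multiset.mem_map.1 hx
        exact hcon y hy
      rw [Multiset.sum_cons] at h0
      rw [← neg_eq_of_add_eq_zero_right h0, map_neg] at hsum
      linarith
    have hbP := hs b (Multiset.mem_cons_of_mem hb)
    have hroot : a + b ∈ ctx.Δ := by
      rw [← sub_neg_eq_add]
      refine hsl.sub_mem (ctx.pos_subset haP) (ctx.neg_mem_Δ b (ctx.pos_subset hbP)) ?_ ?_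
      · rintro rfl
        exact ctx.pos_not_neg b hbP haP
      · rw [map_neg]; linarith
    obtain ⟨u, rfl⟩ := Multiset.exists_cons_of_mem hb
    have key := ih ((a + b) ::ₘ u).card (by simp [← hn]) ((a + b) ::ₘ u) ?_ ?_ rfl
    · exact absurd key Multiset.cons_ne_zero
    · intro x hx
      rcases Multiset.mem_cons.1 hx with rfl | hx
      · exact ctx.add_pos_mem a haP b hbP hroot
      · exact hs x (by simp [hx])
    · simpa [add_assoc] using h0

theorem SimplyLaced.neg_notMem_closure (hsl : ctx.SimplyLaced) {γ : V} (hγ : γ ∈ ctx.Pos) :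
    -γ ∉ AddSubmonoid.closure ctx.Pos := by
  intro h
  obtain ⟨s, hs, hsum⟩ := AddSubmonoid.exists_multiset_of_mem_closure h
  refine Multiset.cons_ne_zero (hsl.multiset_eq_zero (γ ::ₘ s) ?_ ?_)
  · intro x hx
    rcases Multiset.mem_cons.1 hx with rfl | hx
    exacts [hγ, hs x hx]
  · simp [hsum]

theorem SimplyLaced.pos_mem_closure_simple (hsl : ctx.SimplyLaced) {μ : V} (hμ : μ ∈ ctx.Pos) :
    μ ∈ AddSubmonoid.closure ctx.simple := by
  have hfin : ∀ μ : V, {ν | ν ∈ ctx.Pos ∧ ctx.le ν μ}.Finite := fun μ =>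
    (ctx.Δ_finite.subset ctx.pos_subset).subset fun ν hν => hν.1
  have hlt : ∀ β ∈ ctx.Pos, ∀ γ ∈ ctx.Pos, β + γ ∈ ctx.Pos →
      {ν | ν ∈ ctx.Pos ∧ ctx.le ν β}.ncard < {ν | ν ∈ ctx.Pos ∧ ctx.le ν (β + γ)}.ncard := by
    intro β _ γ hγ hsum
    refine Set.ncard_lt_ncard ⟨?_, ?_⟩ (hfin _)
    · rintro ν ⟨hν, hle⟩
      refine ⟨hν, ?_⟩
      have := add_mem hle (AddSubmonoid.subset_closure hγ)
      rwa [show β - ν + γ = β + γ - ν by abel] at this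
    · intro hsub
      have hle : ctx.le (β + γ) β := (hsub ⟨hsum, by simp [le]⟩).2
      refine hsl.neg_notMem_closure hγ ?_
      rwa [le, show β - (β + γ) = -γ by abel] at hle
  induction hn : {ν | ν ∈ ctx.Pos ∧ ctx.le ν μ}.ncard using Nat.strong_induction_on
    generalizing μ with
  | _ n ih =>
    by_cases hs : μ ∈ ctx.simple
    · exact AddSubmonoid.subset_closure hs
    · obtain ⟨β, hβ, γ, hγ, rfl⟩ : ∃ β ∈ ctx.Pos, ∃ γ ∈ ctx.Pos, μ = β + γ := by
        by_contra hcon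
        exact hs ⟨hμ, hcon⟩
      refine add_mem (ih _ ?_ hβ rfl) (ih _ ?_ hγ rfl)
      · rw [← hn]
        exact hlt β hβ γ hγ hμ
      · rw [← hn, add_comm β γ]
        exact hlt γ hγ β hβ (by rwa [add_comm])

/-- A non-simple positive root is the sum of a simple root and a positive root. -/
theorem SimplyLaced.exists_simple_add (hsl : ctx.SimplyLaced) {μ : V} (hμ : μ ∈ ctx.Pos)
    (hns : μ ∉ ctx.simple) : ∃ α ∈ ctx.simple, ∃ β ∈ ctx.Pos, μ = α + β := by
  obtain ⟨α, hα, hpos⟩ : ∃ α ∈ ctx.simple, 0 < ctx.B μ α := by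
    by_contra! hcon
    have : ∀ x ∈ AddSubmonoid.closure ctx.simple, ctx.B μ x ≤ 0 := by
      intro x hx
      induction hx using AddSubmonoid.closure_induction with
      | mem x hx => exact hcon x hx
      | zero => simp
      | add x y _ _ hx hy => rw [map_add]; linarith
    exact (this μ (hsl.pos_mem_closure_simple hμ)).not_gt (B_self_pos (ctx.pos_subset hμ))
  have hne : μ ≠ α := fun h => hns (h ▸ hα)
  have hroot := hsl.sub_mem (ctx.pos_subset hμ) (ctx.pos_subset hα.1) hne hpos
  refine ⟨α, hα, μ - α, ?_, by abel⟩
  rcases ctx.mem_pos_or_neg_pos _ hroot with h | h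
  · exact h
  · exact absurd ⟨μ, hμ, _, h, by abel⟩ hα.2

theorem SimplyLaced.cartan_add_left (hsl : ctx.SimplyLaced) {α β : V} (hα : α ∈ ctx.Δ)
    (hβ : β ∈ ctx.Δ) (hαβ : α + β ∈ ctx.Δ) : 2 * ctx.B (α + β) α / ctx.B α α = 1 := by
  have hN := B_self_pos hα
  have h := hsl _ hαβ α hα
  simp only [map_add, LinearMap.add_apply] at h ⊢
  rw [hsl β hβ α hα, ctx.B_symm β α] at h
  rw [div_eq_one_iff_eq hN.ne', ctx.B_symm β α]
  linarith

theorem SimplyLaced.reflect_simple_mem_pos (hsl : ctx.SimplyLaced) {α ν : V}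
    (hα : α ∈ ctx.simple) (hν : ν ∈ ctx.Pos) (hne : ν ≠ α) :
    ν - (2 * ctx.B ν α / ctx.B α α) • α ∈ ctx.Pos := by
  have hαΔ := ctx.pos_subset hα.1
  have hνΔ := ctx.pos_subset hν
  rcases lt_trichotomy (ctx.B ν α) 0 with h | h | h
  · have hne' : ν ≠ -α := fun h => ctx.pos_not_neg α hα.1 (h ▸ hν)
    have hpos : 0 < ctx.B ν (-α) := by rw [map_neg]; linarith
    have hc := hsl.cartan_eq_one hνΔ (ctx.neg_mem_Δ α hαΔ) hne' hpos
    have hroot := hsl.sub_mem hνΔ (ctx.neg_mem_Δ α hαΔ) hne' hpos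
    have hc' : 2 * ctx.B ν α / ctx.B α α = -1 := by
      simp only [map_neg, LinearMap.neg_apply, neg_neg] at hc
      rw [← hc]; ring
    rw [hc', neg_one_smul, sub_neg_eq_add]
    rw [sub_neg_eq_add] at hroot
    exact ctx.add_pos_mem ν hν α hα.1 hroot
  · simpa [h] using hν
  · have hroot := hsl.sub_mem hνΔ hαΔ hne h
    rw [hsl.cartan_eq_one hνΔ hαΔ hne h, one_smul]
    rcases ctx.mem_pos_or_neg_pos _ hroot with h | h
    · exact h
    · exact absurd ⟨ν, hν, _, h, by abel⟩ hα.2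

theorem SimplyLaced.theta_add_notMem (hsl : ctx.SimplyLaced) {ν : V} (hν : ν ∈ ctx.Pos) :
    ctx.θ + ν ∉ ctx.Δ := fun h =>
  hsl.neg_notMem_closure hν (by simpa using ctx.θ_highest _ h)

/-! ### Affine roots -/

theorem mem_Δhat {ν : V} {m : ℤ} : (ν, (m : ℚ), (0 : ℚ)) ∈ ctx.Δhat ↔ ν ∈ ctx.Δ := by
  refine ⟨?_, fun h => ⟨ν, h, m, rfl⟩⟩
  rintro ⟨α, hα, k, h⟩
  obtain rfl : ν = α := (Prod.ext_iff.1 h).1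
  exact hα

theorem mem_PosHat {ν : V} {m : ℤ} : (ν, (m : ℚ), (0 : ℚ)) ∈ ctx.PosHat ↔
    (m = 0 ∧ ν ∈ ctx.Pos) ∨ (1 ≤ m ∧ ν ∈ ctx.Δ) := by
  constructor
  · rintro (⟨α, hα, h⟩ | ⟨α, hα, k, hk, h⟩) <;> simp only [Prod.mk.injEq] at h
    · obtain ⟨rfl, hm, -⟩ := h
      exact Or.inl ⟨by exact_mod_cast hm, hα⟩
    · obtain ⟨rfl, hm, -⟩ := h
      obtain rfl : m = k := by exact_mod_cast hm
      exact Or.inr ⟨hk, hα⟩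
  · rintro (⟨rfl, h⟩ | ⟨hm, h⟩)
    · exact Or.inl ⟨ν, h, by simp⟩
    · exact Or.inr ⟨ν, h, m, hm, rfl⟩

theorem finite_mem_PosHat {ν : V} : (ν, (0 : ℚ), (0 : ℚ)) ∈ ctx.PosHat ↔ ν ∈ ctx.Pos := by
  have := mem_PosHat (ctx := ctx) (ν := ν) (m := 0)
  simpa using this

theorem PosHat_subset {x : V × ℚ × ℚ} (hx : x ∈ ctx.PosHat) : x ∈ ctx.Δhat := by
  rcases hx with ⟨α, hα, rfl⟩ | ⟨α, hα, k, -, rfl⟩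
  · exact ⟨α, ctx.pos_subset hα, 0, by simp⟩
  · exact ⟨α, hα, k, rfl⟩

theorem PosHat_or_neg {x : V × ℚ × ℚ} (hx : x ∈ ctx.Δhat) :
    x ∈ ctx.PosHat ∨ -x ∈ ctx.PosHat := by
  obtain ⟨α, hα, k, rfl⟩ := hx
  have hneg : -((α, (k : ℚ), (0 : ℚ)) : V × ℚ × ℚ) = (-α, ((-k : ℤ) : ℚ), 0) := by simp
  rw [hneg, mem_PosHat, mem_PosHat]
  have := ctx.neg_mem_Δ α hα
  rcases lt_trichotomy k 0 with h | h | h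
  · exact Or.inr (Or.inr ⟨by omega, this⟩)
  · rcases ctx.mem_pos_or_neg_pos α hα with h' | h'
    · exact Or.inl (Or.inl ⟨h, h'⟩)
    · exact Or.inr (Or.inl ⟨by omega, h'⟩)
  · exact Or.inl (Or.inr ⟨by omega, hα⟩)

theorem PosHat_not_neg {x : V × ℚ × ℚ} (hx : x ∈ ctx.PosHat) : -x ∉ ctx.PosHat := by
  obtain ⟨α, hα, k, rfl⟩ := PosHat_subset hx
  have hneg : -((α, (k : ℚ), (0 : ℚ)) : V × ℚ × ℚ) = (-α, ((-k : ℤ) : ℚ), 0) := by simp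
  rw [hneg, mem_PosHat]
  rw [mem_PosHat] at hx
  have := ctx.pos_not_neg α
  rintro (⟨h1, h2⟩ | ⟨h1, h2⟩) <;> rcases hx with ⟨h3, h4⟩ | ⟨h3, h4⟩ <;> first
    | omega
    | exact this h4 h2

theorem PosHat_add {x y : V × ℚ × ℚ} (hx : x ∈ ctx.PosHat) (hy : y ∈ ctx.PosHat)
    (hxy : x + y ∈ ctx.Δhat) : x + y ∈ ctx.PosHat := by
  obtain ⟨α, hα, k, rfl⟩ := PosHat_subset hx
  obtain ⟨β, hβ, l, rfl⟩ := PosHat_subset hy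
  have hadd : ((α, (k : ℚ), (0 : ℚ)) : V × ℚ × ℚ) + (β, (l : ℚ), 0)
      = (α + β, ((k + l : ℤ) : ℚ), 0) := by simp
  rw [hadd] at hxy ⊢
  rw [mem_Δhat] at hxy
  rw [mem_PosHat] at *
  rcases hx with ⟨h1, h2⟩ | ⟨h1, h2⟩ <;> rcases hy with ⟨h3, h4⟩ | ⟨h3, h4⟩
  · exact Or.inl ⟨by omega, ctx.add_pos_mem α h2 β h4 hxy⟩
  all_goals exact Or.inr ⟨by omega, hxy⟩

theorem refl_apply {α : V} (hα : α ∈ ctx.Δ) (k : ℤ) (ν : V) (m : ℚ) :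
    ctx.refl (α, (k : ℚ), 0) (ν, m, 0) =
      (ν - (2 * ctx.B ν α / ctx.B α α) • α, m - 2 * ctx.B ν α / ctx.B α α * k, 0) := by
  have hB : ctx.Bhat (α, (k : ℚ), 0) (α, (k : ℚ), 0) = ctx.B α α := by simp [Bhat]
  have hB' : ctx.Bhat (α, (k : ℚ), 0) (ν, m, 0) = ctx.B ν α := by
    simp [Bhat, ctx.B_symm α ν]
  have hN := (B_self_pos hα).ne'
  rw [refl, dif_neg (by rwa [hB]), Module.reflection_apply]
  simp only [LinearMap.smul_apply, hB, hB', smul_eq_mul]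
  ext
  · simp [div_mul_eq_mul_div]
  · simp [div_mul_eq_mul_div]
  · simp

theorem refl_δhat {α : V} (hα : α ∈ ctx.Δ) (k : ℤ) :
    ctx.refl (α, (k : ℚ), 0) ctx.δhat = ctx.δhat := by
  simp [δhat, refl_apply hα]

theorem refl_mem_Δhat {α : V} (hα : α ∈ ctx.Δ) (k : ℤ) {x : V × ℚ × ℚ} (hx : x ∈ ctx.Δhat) :
    ctx.refl (α, (k : ℚ), 0) x ∈ ctx.Δhat := by
  obtain ⟨ν, hν, m, rfl⟩ := hx
  obtain ⟨n, hn⟩ := ctx.crystallographic ν hν α hα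
  rw [refl_apply hα]
  exact ⟨_, ctx.reflect_mem α hα ν hν, m - n * k, by simp [hn]⟩

theorem refl_refl {α : V} (hα : α ∈ ctx.Δ) (k : ℤ) (x : V × ℚ × ℚ) :
    ctx.refl (α, (k : ℚ), 0) (ctx.refl (α, (k : ℚ), 0) x) = x := by
  have hB : ctx.Bhat (α, (k : ℚ), 0) (α, (k : ℚ), 0) = ctx.B α α := by simp [Bhat]
  rw [refl, dif_neg (by rw [hB]; exact (B_self_pos hα).ne')]
  exact Module.involutive_reflection _ x

theorem What_preserves {w : (V × ℚ × ℚ) ≃ₗ[ℚ] (V × ℚ × ℚ)} (hw : w ∈ ctx.What) :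
    w ctx.δhat = ctx.δhat ∧ ∀ x, w x ∈ ctx.Δhat ↔ x ∈ ctx.Δhat := by
  induction hw using Subgroup.closure_induction with
  | mem g hg =>
    obtain ⟨β, ⟨α, hα, k, rfl⟩, rfl⟩ := hg
    refine ⟨refl_δhat hα k, fun x => ⟨fun h => ?_, refl_mem_Δhat hα k⟩⟩
    simpa [refl_refl hα k] using refl_mem_Δhat hα k h
  | one => simp
  | mul f g _ _ hf hg =>
    exact ⟨by simp [LinearEquiv.mul_apply, hg.1, hf.1], fun x => by
      rw [LinearEquiv.mul_apply, hf.2, hg.2]⟩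
  | inv f _ hf =>
    have hinv : ∀ x, f (f⁻¹ x) = x := fun x => f.apply_symm_apply x
    exact ⟨f.injective (by rw [hinv, hf.1]), fun x => by rw [← hf.2, hinv]⟩

theorem SimplyLaced.refl_simple_mem_PosHat (hsl : ctx.SimplyLaced) {α : V}
    (hα : α ∈ ctx.simple) {x : V × ℚ × ℚ} (hx : x ∈ ctx.PosHat) (hne : x ≠ ctx.emb α) :
    ctx.refl (ctx.emb α) x ∈ ctx.PosHat := by
  obtain ⟨ν, hν, m, rfl⟩ := PosHat_subset hx
  have hαΔ := ctx.pos_subset hα.1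
  have h := refl_apply hαΔ 0 ν m
  simp only [Int.cast_zero, mul_zero, sub_zero] at h
  rw [emb, h, mem_PosHat]
  rcases mem_PosHat.1 hx with ⟨rfl, hP⟩ | ⟨hm, -⟩
  · refine Or.inl ⟨rfl, hsl.reflect_simple_mem_pos hα hP ?_⟩
    rintro rfl
    exact hne (by simp [emb])
  · exact Or.inr ⟨hm, ctx.reflect_mem α hαΔ ν hν⟩

/-! ### Minuscule elements -/

theorem δhat_sub_emb (γ : V) : ctx.δhat - ctx.emb γ = (-γ, ((1 : ℤ) : ℚ), 0) := by
  simp [δhat, emb]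

theorem δhat_sub_emb_mem_PosHat {γ : V} (hγ : γ ∈ ctx.Δ) :
    ctx.δhat - ctx.emb γ ∈ ctx.PosHat := by
  rw [δhat_sub_emb]
  exact mem_PosHat.2 (Or.inr ⟨le_rfl, ctx.neg_mem_Δ γ hγ⟩)

variable {w : (V × ℚ × ℚ) ≃ₗ[ℚ] (V × ℚ × ℚ)}

theorem IsMinuscule.apply_mem_PosHat (hw : ctx.IsMinuscule w) {ν : V} {m : ℤ} (hm : m ≠ 1)
    (hν : (ν, (m : ℚ), (0 : ℚ)) ∈ ctx.PosHat) : w (ν, (m : ℚ), (0 : ℚ)) ∈ ctx.PosHat := by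
  rcases PosHat_or_neg (((What_preserves hw.1).2 _).2 (PosHat_subset hν)) with h | h
  · exact h
  · obtain ⟨γ, -, hγ⟩ := hw.2 _ ⟨hν, h⟩
    rw [δhat_sub_emb] at hγ
    simp only [Prod.mk.injEq, Int.cast_inj] at hγ
    exact absurd hγ.2.1 hm

theorem IsMinuscule.apply_emb_mem_PosHat (hw : ctx.IsMinuscule w) {γ : V} (hγ : γ ∈ ctx.Pos) :
    w (ctx.emb γ) ∈ ctx.PosHat := by
  have := hw.apply_mem_PosHat (m := 0) (ν := γ) (by simp) (mem_PosHat.2 (Or.inl ⟨rfl, hγ⟩))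
  simpa [emb] using this

theorem IsMinuscule.isAbelianIdeal (hw : ctx.IsMinuscule w) :
    ctx.IsAbelianIdeal (ctx.idealOf w) := by
  refine ⟨fun γ hγ => hγ.1, ?_, ?_⟩
  · rintro γ ⟨hγ, -, hγw⟩ ν ⟨hν, -, hνw⟩ hsum
    have heq : -w (ctx.δhat - ctx.emb γ) + -w (ctx.δhat - ctx.emb ν)
        = -w (-(γ + ν), ((2 : ℤ) : ℚ), 0) := by
      rw [← neg_add, ← map_add]
      congr 2
      simp only [δhat_sub_emb, Prod.mk_add_mk]
      ext
      · simp [add_comm]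
      · norm_num
      · simp
    have hpos := hw.apply_mem_PosHat (m := 2) (ν := -(γ + ν)) (by norm_num)
      (mem_PosHat.2 (Or.inr ⟨by norm_num, ctx.neg_mem_Δ _ hsum⟩))
    have hneg := PosHat_add hγw hνw (by
      rw [heq, ← map_neg, (What_preserves hw.1).2]
      exact ⟨γ + ν, hsum, -2, by simp⟩)
    rw [heq] at hneg
    exact PosHat_not_neg hpos hneg
  · rintro γ ⟨hγ, -, hγw⟩ ν hν hsum
    refine ⟨ctx.add_pos_mem γ hγ ν hν hsum, δhat_sub_emb_mem_PosHat hsum, ?_⟩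
    have heq : -w (ctx.δhat - ctx.emb γ) + w (ctx.emb ν)
        = -w (ctx.δhat - ctx.emb (γ + ν)) := by
      rw [← map_neg, ← map_neg, ← map_add]
      congr 1
      ext <;> simp [δhat, emb, add_comm]
    rw [← heq]
    refine PosHat_add hγw (hw.apply_emb_mem_PosHat hν) ?_
    rw [heq, ← map_neg, (What_preserves hw.1).2, δhat_sub_emb]
    exact ⟨γ + ν, hsum, -1, by simp⟩

/-- A decomposition of the rootlet of a minuscule element into positive roots comes from a
decomposition of the highest root. -/
theorem IsMinuscule.exists_theta_eq_add (hsl : ctx.SimplyLaced) (hw : ctx.IsMinuscule w)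
    {α β : V} (hα : α ∈ ctx.Pos) (hβ : β ∈ ctx.Pos)
    (hroot : w ctx.alpha0 + ctx.δhat = ctx.emb (α + β)) :
    ∃ γ ∈ ctx.Pos, ∃ γ' ∈ ctx.Pos, γ + γ' = ctx.θ ∧
      w (ctx.δhat - ctx.emb γ) = ctx.emb α ∧ w (ctx.δhat - ctx.emb γ') = ctx.emb β := by
  have hpre : ∀ β ∈ ctx.Pos, ∃ ν ∈ ctx.Δ, ∃ k : ℤ, w (ν, (k : ℚ), 0) = ctx.emb β := by
    intro β hβ
    have h : w.symm (ctx.emb β) ∈ ctx.Δhat := by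
      rw [← (What_preserves hw.1).2, w.apply_symm_apply]
      exact PosHat_subset (finite_mem_PosHat.2 hβ)
    obtain ⟨ν, hν, k, h⟩ := h
    exact ⟨ν, hν, k, by rw [← h, w.apply_symm_apply]⟩
  obtain ⟨ν, hν, k, hνk⟩ := hpre α hα
  obtain ⟨ν', hν', k', hνk'⟩ := hpre β hβ
  have hsum : ((ν, (k : ℚ), (0 : ℚ)) : V × ℚ × ℚ) + (ν', (k' : ℚ), 0)
      = ctx.alpha0 + ctx.δhat := by
    apply w.injective
    rw [map_add, map_add, hνk, hνk', (What_preserves hw.1).1, hroot]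
    simp [emb]
  simp only [alpha0, δhat, Prod.mk_add_mk, Prod.mk.injEq, add_zero] at hsum
  obtain ⟨hθ, hk, -⟩ := hsum
  have hk2 : k + k' = 2 := by
    have : ((k + k' : ℤ) : ℚ) = ((2 : ℤ) : ℚ) := by push_cast; rw [hk]; norm_num
    exact_mod_cast this
  have hnegpos : ∀ ν ∈ ctx.Δ, ∀ ν' ∈ ctx.Δ, ν + ν' = -ctx.θ → -ν ∈ ctx.Pos := by
    intro ν hν ν' hν' h
    rcases ctx.mem_pos_or_neg_pos ν hν with hp | hp
    · refine absurd ?_ (hsl.theta_add_notMem hp)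
      have := ctx.neg_mem_Δ ν' hν'
      rwa [show ctx.θ + ν = -ν' by rw [← neg_neg ctx.θ, ← h]; abel]
    · exact hp
  have hge : ∀ (β ν : V) (k : ℤ), β ∈ ctx.Pos → -ν ∈ ctx.Pos →
      w (ν, (k : ℚ), 0) = ctx.emb β → 1 ≤ k := by
    intro β ν k hβ hν h
    have hp := hw.apply_emb_mem_PosHat hν
    have heq : w (ctx.emb (-ν)) = (-β, (k : ℚ), 0) := by
      have : ctx.emb (-ν) = (k : ℚ) • ctx.δhat - (ν, (k : ℚ), 0) := by
        ext <;> simp [emb, δhat]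
      rw [this, map_sub, map_smul, (What_preserves hw.1).1, h]
      ext <;> simp [emb, δhat]
    rw [heq, mem_PosHat] at hp
    rcases hp with ⟨-, hp⟩ | ⟨hp, -⟩
    · exact absurd hp (ctx.pos_not_neg β hβ)
    · exact hp
  have hn := hnegpos ν hν ν' hν' hθ
  have hn' := hnegpos ν' hν' ν hν (by rw [add_comm, hθ])
  have h1 := hge α ν k hα hn hνk
  have h1' := hge β ν' k' hβ hn' hνk'
  obtain rfl : k = 1 := by omega
  obtain rfl : k' = 1 := by omega
  refine ⟨-ν, hn, -ν', hn', ?_, ?_, ?_⟩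
  · rw [← neg_add, hθ, neg_neg]
  · rw [δhat_sub_emb, neg_neg, hνk]
  · rw [δhat_sub_emb, neg_neg, hνk']

/-- Enlarging a minuscule element by a simple reflection. -/
theorem IsMinuscule.refl_mul (hsl : ctx.SimplyLaced) (hw : ctx.IsMinuscule w) {α γ : V}
    (hα : α ∈ ctx.simple) (hγ : γ ∈ ctx.Pos) (h : w (ctx.δhat - ctx.emb γ) = ctx.emb α) :
    ctx.IsMinuscule (ctx.refl (ctx.emb α) * w) ∧
      ctx.idealOf w ⊆ ctx.idealOf (ctx.refl (ctx.emb α) * w) ∧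
      γ ∈ ctx.idealOf (ctx.refl (ctx.emb α) * w) ∧ γ ∉ ctx.idealOf w := by
  have hαΔ := ctx.pos_subset hα.1
  have hγΔ := ctx.pos_subset hγ
  have hαhat : ctx.emb α ∈ ctx.PosHat := finite_mem_PosHat.2 hα.1
  have hrefl : ctx.refl (ctx.emb α) ∈ ctx.What :=
    Subgroup.subset_closure ⟨_, PosHat_subset hαhat, rfl⟩
  refine ⟨⟨mul_mem hrefl hw.1, ?_⟩, ?_, ⟨hγ, δhat_sub_emb_mem_PosHat hγΔ, ?_⟩, ?_⟩
  · rintro x ⟨hx, hxw⟩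
    rw [LinearEquiv.mul_apply] at hxw
    rcases PosHat_or_neg (((What_preserves hw.1).2 _).2 (PosHat_subset hx)) with hp | hp
    · by_cases hxα : w x = ctx.emb α
      · exact ⟨γ, hγ, w.injective (by rw [hxα, h])⟩
      · exact absurd hxw (PosHat_not_neg (hsl.refl_simple_mem_PosHat hα hp hxα))
    · exact hw.2 x ⟨hx, hp⟩
  · rintro ν ⟨hν, hνp, hνw⟩
    refine ⟨hν, hνp, ?_⟩
    rw [LinearEquiv.mul_apply, ← map_neg]
    refine hsl.refl_simple_mem_PosHat hα hνw fun hcon => ?_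
    rw [← h, ← map_neg] at hcon
    have := w.injective hcon
    refine PosHat_not_neg hνp ?_
    rw [this]
    exact δhat_sub_emb_mem_PosHat hγΔ
  · rw [LinearEquiv.mul_apply, h]
    have hr := refl_apply hαΔ 0 α 0
    have h2 : 2 * ctx.B α α / ctx.B α α = 2 := by
      have := (B_self_pos hαΔ).ne'
      field_simp
    rw [h2] at hr
    simp only [Int.cast_zero, mul_zero, sub_zero] at hr
    rw [emb, hr]
    have heq : -((α - (2 : ℚ) • α, (0 : ℚ), (0 : ℚ)) : V × ℚ × ℚ) = ctx.emb α := by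
      simp [emb, two_smul]
    rw [heq]
    exact hαhat
  · rintro ⟨-, -, hcon⟩
    rw [h] at hcon
    exact PosHat_not_neg hαhat hcon

theorem SimplyLaced.rootlet_refl_mul (hsl : ctx.SimplyLaced) {α β : V} (hα : α ∈ ctx.Δ)
    (hβ : β ∈ ctx.Δ) (hαβ : α + β ∈ ctx.Δ)
    (hroot : w ctx.alpha0 + ctx.δhat = ctx.emb (α + β)) :
    (ctx.refl (ctx.emb α) * w) ctx.alpha0 + ctx.δhat = ctx.emb β := by
  have hδ : ctx.refl (ctx.emb α) ctx.δhat = ctx.δhat := by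
    simpa [emb] using refl_δhat hα 0
  have hr := refl_apply hα 0 (α + β) 0
  rw [hsl.cartan_add_left hα hβ hαβ] at hr
  rw [LinearEquiv.mul_apply]
  nth_rw 1 [← hδ]
  rw [← map_add, hroot]
  simpa [emb] using hr

theorem IsMinuscule.rootlet_mem_pos (hw : ctx.IsMinuscule w) {μ : V}
    (hroot : w ctx.alpha0 + ctx.δhat = ctx.emb μ) : μ ∈ ctx.Pos := by
  have h := hw.apply_mem_PosHat (m := 2) (ν := -ctx.θ) (by norm_num)
    (mem_PosHat.2 (Or.inr ⟨by norm_num, ctx.neg_mem_Δ _ (ctx.pos_subset ctx.θ_pos)⟩))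
  have heq : ((-ctx.θ, ((2 : ℤ) : ℚ), (0 : ℚ)) : V × ℚ × ℚ) = ctx.alpha0 + ctx.δhat := by
    ext
    · simp [alpha0, δhat]
    · norm_num [alpha0, δhat]
    · simp [alpha0, δhat]
  rw [heq, map_add, (What_preserves hw.1).1, hroot] at h
  exact finite_mem_PosHat.1 h

theorem IsAbelianIdeal.exists_maximal {I : Set V} (hI : ctx.IsAbelianIdeal I) :
    ∃ J, (ctx.IsAbelianIdeal J ∧ ∀ K, ctx.IsAbelianIdeal K → J ⊆ K → J = K) ∧ I ⊆ J := by
  have hfin : {J | ctx.IsAbelianIdeal J}.Finite :=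
    (ctx.Δ_finite.subset ctx.pos_subset).finite_subsets.subset fun J hJ => hJ.1
  obtain ⟨J, hIJ, hJ⟩ := hfin.exists_le_maximal hI
  exact ⟨J, ⟨hJ.1, fun K hK hJK => hJ.eq_of_le hK hJK⟩, hIJ⟩

theorem IsMinuscule.exists_two_maximal (hsl : ctx.SimplyLaced) (hw : ctx.IsMinuscule w) {μ : V}
    (hroot : w ctx.alpha0 + ctx.δhat = ctx.emb μ) (hμ : μ ∉ ctx.simple) :
    ∃ J₁ J₂ : Set V, J₁ ≠ J₂ ∧
      (ctx.IsAbelianIdeal J₁ ∧ ∀ K, ctx.IsAbelianIdeal K → J₁ ⊆ K → J₁ = K) ∧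
      (ctx.IsAbelianIdeal J₂ ∧ ∀ K, ctx.IsAbelianIdeal K → J₂ ⊆ K → J₂ = K) ∧
      ctx.idealOf w ⊆ J₁ ∧ ctx.idealOf w ⊆ J₂ := by
  induction hn : (ctx.Pos \ ctx.idealOf w).ncard using Nat.strong_induction_on
    generalizing w μ with
  | _ n ih =>
    have hμP := hw.rootlet_mem_pos hroot
    obtain ⟨α, hα, β, hβ, rfl⟩ := hsl.exists_simple_add hμP hμ
    obtain ⟨γ, hγ, γ', hγ', hθ, hγw, hγw'⟩ := hw.exists_theta_eq_add hsl hα.1 hβ hroot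
    obtain ⟨hm, hsub, hmem, hnot⟩ := hw.refl_mul hsl hα hγ hγw
    by_cases hβs : β ∈ ctx.simple
    · obtain ⟨hm', hsub', hmem', -⟩ := hw.refl_mul hsl hβs hγ' hγw'
      obtain ⟨J₁, hJ₁, hI₁⟩ := hm.isAbelianIdeal.exists_maximal
      obtain ⟨J₂, hJ₂, hI₂⟩ := hm'.isAbelianIdeal.exists_maximal
      refine ⟨J₁, J₂, ?_, hJ₁, hJ₂, hsub.trans hI₁, hsub'.trans hI₂⟩
      rintro rfl
      refine hJ₁.1.2.1 γ (hI₁ hmem) γ' (hI₂ hmem') ?_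
      rw [hθ]
      exact ctx.pos_subset ctx.θ_pos
    · have hlt : (ctx.Pos \ ctx.idealOf (ctx.refl (ctx.emb α) * w)).ncard < n := by
        rw [← hn]
        refine Set.ncard_lt_ncard ⟨Set.sdiff_subset_sdiff_right hsub, fun h => ?_⟩
          ((ctx.Δ_finite.subset ctx.pos_subset).subset Set.sdiff_subset)
        exact (h ⟨hγ, hnot⟩).2 hmem
      obtain ⟨J₁, J₂, hne, hJ₁, hJ₂, hI₁, hI₂⟩ := ih _ hlt hm
        (hsl.rootlet_refl_mul (ctx.pos_subset hα.1) (ctx.pos_subset hβ) (ctx.pos_subset hμP)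
          hroot) hβs rfl
      exact ⟨J₁, J₂, hne, hJ₁, hJ₂, hsub.trans hI₁, hsub.trans hI₂⟩

end RootSystemCtx

/-- Theorem `not-max` 3: in the simply-laced case, if the rootlet
of `I_w` is not simple, then `I_w` lies in at least two distinct maximal abelian
ideals. -/
theorem statement_6 {V : Type*} [AddCommGroup V] [Module ℚ V] (ctx : RootSystemCtx V)
    (hsl : ∀ α ∈ ctx.Δ, ∀ β ∈ ctx.Δ, ctx.B α α = ctx.B β β)
    (w : (V × ℚ × ℚ) ≃ₗ[ℚ] (V × ℚ × ℚ)) (hw : ctx.IsMinuscule w)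
    (hne : (ctx.idealOf w).Nonempty)
    (μ : V) (hroot : w ctx.alpha0 + ctx.δhat = ctx.emb μ) (hμns : μ ∉ ctx.simple) :
    ∃ J₁ J₂ : Set V, J₁ ≠ J₂ ∧
      (ctx.IsAbelianIdeal J₁ ∧ ∀ K, ctx.IsAbelianIdeal K → J₁ ⊆ K → J₁ = K) ∧
      (ctx.IsAbelianIdeal J₂ ∧ ∀ K, ctx.IsAbelianIdeal K → J₂ ⊆ K → J₂ = K) ∧
      ctx.idealOf w ⊆ J₁ ∧ ctx.idealOf w ⊆ J₂ := by
  exact hw.exists_two_maximal hsl hroot hμns
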